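/- arXiv:2001.05258 — 2 statements merged into one kernel-verified Lean document; each statement's English description precedes it below -/
import Mathlib

section
/- Let k ≥ 2. Suppose G is a graph with minimum degree at least k+1 and λ_k(G) > 0 (G has no k-matching of size ⌊kn/2⌋). Let F be a maximum k-matching and x a vertex with d_F(x) < k. Then there exists a nonempty vertex set S_x with e(S_x) ≥ (13/12)|S_x|, and at least (|S_x|/(k+1)) − 1 vertices y of S_x have the property that some maximum k-matching F' of G leaves both x and y unsaturated (d_{F'}(x) < k and d_{F'}(y) < k), so that λ_k(G + xy) < λ_k(G). -/
open Finset
open scoped Classical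

/-- Number of edges of `G` with both endpoints in `S`. -/
noncomputable def edgesIn {V : Type*} [Fintype V] (G : SimpleGraph V) (S : Finset V) : ℕ :=
  (G.edgeFinset.filter (fun e => ∀ v ∈ e, v ∈ S)).card

/-- Degree of a vertex in an edge set. -/
noncomputable def edgeDeg {V : Type*} (F : Finset (Sym2 V)) (v : V) : ℕ :=
  (F.filter (fun e => v ∈ e)).card

/-- A `k`-matching. -/
def IsKMatching {V : Type*} [Fintype V] (G : SimpleGraph V) (k : ℕ) (F : Finset (Sym2 V)) : Prop :=
  F ⊆ G.edgeFinset ∧ ∀ v : V, edgeDeg F v ≤ k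

/-- Maximum size of a `k`-matching in `G`. -/
noncomputable def maxKMatch {V : Type*} [Fintype V] (G : SimpleGraph V) (k : ℕ) : ℕ :=
  (G.edgeFinset.powerset.filter (fun F => IsKMatching G k F)).sup Finset.card

/-- The `k`-matching deficiency `λ_k(G)`. -/
noncomputable def lamK {V : Type*} [Fintype V] (G : SimpleGraph V) (k : ℕ) : ℕ :=
  k * Fintype.card V / 2 - maxKMatch G k

/-- `Y x`: vertices `y ≠ x` such that some maximum `k`-matching leaves both `x` and `y`
unsaturated. -/
noncomputable def Yset {V : Type*} [Fintype V] (G : SimpleGraph V) (k : ℕ) (x : V) :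
    Finset V :=
  Finset.univ.filter (fun y : V => y ≠ x ∧
    ∃ F : Finset (Sym2 V), IsKMatching G k F ∧ F.card = maxKMatch G k ∧
      edgeDeg F x < k ∧ edgeDeg F y < k)


lemma aux_deg {V : Type*} [Fintype V] (F : Finset (Sym2 V)) (v : V) :
    edgeDeg F v = (univ.filter (fun w => s(v, w) ∈ F)).card := by
  unfold edgeDeg
  have h : F.filter (fun e => v ∈ e) =
      (univ.filter (fun w => s(v, w) ∈ F)).image (fun w => s(v, w)) := by
    ext e
    simp only [mem_filter, mem_image, mem_univ, true_and]
    constructor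
    · rintro ⟨he, hv⟩
      obtain ⟨w, rfl⟩ := Sym2.mem_iff_exists.mp hv
      exact ⟨w, he, rfl⟩
    · rintro ⟨w, hw, rfl⟩
      exact ⟨hw, Sym2.mem_mk_left v w⟩
  rw [h, card_image_of_injective]
  intro a b hab
  exact Sym2.congr_right.mp hab

lemma aux_sum {V : Type*} [Fintype V] (F : Finset (Sym2 V)) :
    ∑ v, edgeDeg F v ≤ 2 * F.card := by
  have h1 : ∑ v, edgeDeg F v = ∑ e ∈ F, (univ.filter (fun v : V => v ∈ e)).card := by
    unfold edgeDeg
    simp only [card_filter]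
    exact sum_comm
  rw [h1, mul_comm, ← smul_eq_mul]
  apply sum_le_card_nsmul
  intro e _
  induction e using Sym2.ind with
  | _ a b =>
    calc _ ≤ ({a, b} : Finset V).card := by
            apply card_le_card
            intro v hv
            simpa using hv
      _ ≤ 2 := card_le_two

lemma aux_max {V : Type*} [Fintype V] (G : SimpleGraph V) (k : ℕ) (F : Finset (Sym2 V))
    (hF : IsKMatching G k F) : F.card ≤ maxKMatch G k := by
  unfold maxKMatch
  apply Finset.le_sup (f := Finset.card)
  simp only [mem_filter, mem_powerset]
  exact ⟨hF.1, hF⟩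

/-- state at y -/
def StateAt {V : Type*} [Fintype V] (G : SimpleGraph V) (k : ℕ) (x : V)
    (F : Finset (Sym2 V)) (y : V) : Prop :=
  IsKMatching G k F ∧ F.card = maxKMatch G k ∧ edgeDeg F x + 1 ≤ k ∧
    edgeDeg F y + (if y = x then 2 else 1) ≤ k

lemma deg_insert {V : Type*} (F : Finset (Sym2 V)) (e : Sym2 V) (he : e ∉ F) (v : V) :
    edgeDeg (insert e F) v = edgeDeg F v + (if v ∈ e then 1 else 0) := by
  unfold edgeDeg
  rw [filter_insert]
  split_ifs with h
  · rw [card_insert_of_notMem (by simp [he])]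
  · simp

lemma deg_erase {V : Type*} (F : Finset (Sym2 V)) (e : Sym2 V) (he : e ∈ F) (v : V) :
    edgeDeg F v = edgeDeg (F.erase e) v + (if v ∈ e then 1 else 0) := by
  have := deg_insert (F.erase e) e (by simp) v
  rwa [insert_erase he] at this

lemma state_sat {V : Type*} [Fintype V] (G : SimpleGraph V) (k : ℕ) (x : V)
    (F : Finset (Sym2 V)) (y : V) (h : StateAt G k x F y) (v : V) (hv : G.Adj y v)
    (hn : s(y, v) ∉ F) : edgeDeg F v = k := by
  obtain ⟨hF, hc, hx, hy⟩ := h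
  by_contra hne
  have hlt : edgeDeg F v < k := lt_of_le_of_ne (hF.2 v) hne
  have hK : IsKMatching G k (insert s(y, v) F) := by
    refine ⟨?_, ?_⟩
    · intro e he
      rcases mem_insert.mp he with rfl | he
      · simpa using hv
      · exact hF.1 he
    · intro u
      rw [deg_insert _ _ hn]
      have := hF.2 u
      split_ifs with hu
      · rcases Sym2.mem_iff.mp hu with rfl | rfl
        · split_ifs at hy <;> omega
        · omega
      · omega
  have := aux_max G k _ hK
  rw [card_insert_of_notMem hn] at this
  omega

lemma state_step {V : Type*} [Fintype V] (G : SimpleGraph V) (k : ℕ) (x : V)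
    (F : Finset (Sym2 V)) (y : V) (h : StateAt G k x F y) (v : V) (hv : G.Adj y v)
    (hn : s(y, v) ∉ F) (w : V) (hw : s(v, w) ∈ F) :
    StateAt G k x (insert s(y, v) (F.erase s(v, w))) w := by
  have hsat := state_sat G k x F y h v hv hn
  obtain ⟨hF, hc, hx, hy⟩ := h
  have hvx : v ≠ x := by rintro rfl; omega
  have hyv : y ≠ v := hv.ne
  have hwv : v ≠ w := by
    have := hF.1 hw
    rw [SimpleGraph.mem_edgeFinset, SimpleGraph.mem_edgeSet] at this
    exact this.ne
  have hwy : w ≠ y := by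
    rintro rfl
    rw [Sym2.eq_swap] at hw
    exact hn hw
  have hn' : s(y, v) ∉ F.erase s(v, w) := fun h => hn (mem_of_mem_erase h)
  have hd : ∀ u, edgeDeg (insert s(y, v) (F.erase s(v, w))) u + (if u = v ∨ u = w then 1 else 0)
      = edgeDeg F u + (if u = y ∨ u = v then 1 else 0) := by
    intro u
    have h1 := deg_insert _ _ hn' u
    have h2 := deg_erase F _ hw u
    simp only [Sym2.mem_iff] at h1 h2
    omega
  refine ⟨⟨?_, ?_⟩, ?_, ?_, ?_⟩
  · intro e he
    rcases mem_insert.mp he with rfl | he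
    · simpa using hv
    · exact hF.1 (mem_of_mem_erase he)
  · intro u
    have h1 := hd u
    have h2 := hF.2 u
    by_cases huv : u = v
    · subst huv
      simp at h1
      omega
    · by_cases huy : u = y
      · subst huy
        simp [huv, hwy.symm] at h1
        split_ifs at hy <;> omega
      · simp [huv, huy] at h1
        split_ifs at h1 <;> omega
  · rw [card_insert_of_notMem hn', card_erase_of_mem hw]
    have : 0 < F.card := card_pos.mpr ⟨_, hw⟩
    omega
  · have h1 := hd x
    by_cases hyx : y = x
    · subst hyx
      simp [hvx.symm, hwy.symm] at h1 hy
      omega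
    · simp [hvx.symm, Ne.symm hyx] at h1
      omega
  · have h1 := hd w
    simp [hwy, hwv.symm] at h1
    have h2 := hF.2 w
    split_ifs with hwx
    · subst hwx
      omega
    · omega

lemma aux_two {V : Type*} [Fintype V] (G : SimpleGraph V) (k : ℕ)
    (hδ : ∀ v : V, k + 1 ≤ G.degree v) (x : V) (F : Finset (Sym2 V)) (y : V)
    (h : StateAt G k x F y) :
    2 ≤ (univ.filter (fun v => G.Adj y v ∧ s(y, v) ∉ F)).card := by
  have hy : edgeDeg F y + 1 ≤ k := by
    have := h.2.2.2
    split_ifs at this <;> omega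
  rw [aux_deg] at hy
  have h1 := hδ y
  rw [← SimpleGraph.card_neighborFinset_eq_degree] at h1
  have h2 : (G.neighborFinset y).card ≤
      (univ.filter (fun w => s(y, w) ∈ F)).card +
      (univ.filter (fun v => G.Adj y v ∧ s(y, v) ∉ F)).card := by
    refine le_trans (card_le_card ?_) (card_union_le _ _)
    intro v hv
    simp at hv ⊢
    tauto
  omega

lemma aux_edges {V : Type*} [Fintype V] (G : SimpleGraph V) (Y T : Finset V)
    (hT : ∀ t ∈ T, 3 ≤ (Y.filter (fun w => G.Adj t w)).card)
    (hY : ∀ y ∈ Y, 2 ≤ (T.filter (fun w => G.Adj y w)).card) :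
    13 * (Y ∪ T).card ≤ 12 * edgesIn G (Y ∪ T) := by
  have hc : (Y ∪ T).card = (Y \ T).card + T.card := by
    rw [← sdiff_union_self_eq_union, card_union_of_disjoint sdiff_disjoint]
  have h1 : 2 * (Y \ T).card + 3 * T.card ≤ 2 * edgesIn G (Y ∪ T) := by
    refine le_trans ?_ (aux_sum _)
    have hd : ∀ v ∈ Y ∪ T, ∀ R ⊆ Y ∪ T, (R.filter (fun w => G.Adj v w)).card ≤
        edgeDeg (G.edgeFinset.filter (fun e => ∀ v ∈ e, v ∈ Y ∪ T)) v := by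
      intro v hv R hR
      rw [aux_deg]
      apply card_le_card
      intro w hw
      rw [mem_filter] at hw
      simp only [mem_filter, mem_univ, true_and, SimpleGraph.mem_edgeFinset,
        SimpleGraph.mem_edgeSet]
      refine ⟨hw.2, ?_⟩
      intro u hu
      rcases Sym2.mem_iff.mp hu with rfl | rfl
      · exact hv
      · exact hR hw.1
    have h3 : ∑ v ∈ (Y \ T) ∪ T, edgeDeg (G.edgeFinset.filter (fun e => ∀ v ∈ e, v ∈ Y ∪ T)) v
      ≤ ∑ v, edgeDeg (G.edgeFinset.filter (fun e => ∀ v ∈ e, v ∈ Y ∪ T)) v :=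
      sum_le_sum_of_subset (subset_univ _)
    refine le_trans ?_ h3
    rw [sum_union sdiff_disjoint]
    apply add_le_add
    · rw [mul_comm, ← smul_eq_mul]
      apply card_nsmul_le_sum
      intro v hv
      have hv' := (mem_sdiff.mp hv).1
      exact (hY v hv').trans (hd v (mem_union_left _ hv') T subset_union_right)
    · rw [mul_comm, ← smul_eq_mul]
      apply card_nsmul_le_sum
      intro v hv
      exact (hT v hv).trans (hd v (mem_union_right _ hv) Y subset_union_left)
  have h2 : 2 * (Y \ T).card ≤ edgesIn G (Y ∪ T) := by
    have h3 : 2 * (Y \ T).card ≤ ((Y \ T).sigma (fun a => T.filter (fun w => G.Adj a w))).card := by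
      rw [card_sigma, mul_comm, ← smul_eq_mul]
      apply card_nsmul_le_sum
      intro v hv
      exact hY v (mem_sdiff.mp hv).1
    refine h3.trans ?_
    unfold edgesIn
    apply card_le_card_of_injOn (fun p => s(p.1, p.2))
    · rintro ⟨a, b⟩ hp
      simp only [coe_sigma, Set.mem_sigma_iff, mem_coe, mem_sdiff, mem_filter] at hp
      simp only [mem_coe, mem_filter, SimpleGraph.mem_edgeFinset, SimpleGraph.mem_edgeSet]
      refine ⟨hp.2.2, ?_⟩
      intro u hu
      rcases Sym2.mem_iff.mp hu with rfl | rfl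
      · exact mem_union_left _ hp.1.1
      · exact mem_union_right _ hp.2.1
    · rintro ⟨a, b⟩ hp ⟨c, d⟩ hq hpq
      simp only [coe_sigma, Set.mem_sigma_iff, mem_coe, mem_sdiff, mem_filter] at hp hq
      rcases Sym2.eq_iff.mp hpq with ⟨rfl, rfl⟩ | ⟨h1, h2⟩
      · rfl
      · simp only at h1 h2
        subst h1
        exact absurd hq.2.1 hp.1.2
  omega

theorem stmt5 {V : Type*} [Fintype V] [DecidableEq V] (G : SimpleGraph V) (k : ℕ)
    (hk : 2 ≤ k)
    (hδ : ∀ v : V, k + 1 ≤ G.degree v)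
    (hlam : 0 < lamK G k)
    (F : Finset (Sym2 V)) (hF : IsKMatching G k F) (hFmax : F.card = maxKMatch G k)
    (x : V) (hx : edgeDeg F x < k) :
    ∃ S : Finset V, S.Nonempty ∧
      (13 / 12 : ℝ) * S.card ≤ (edgesIn G S : ℝ) ∧
      (S.card : ℝ) / (k + 1) - 1 ≤ ((S ∩ Yset G k x).card : ℝ) := by
  have hinit : ∃ y, StateAt G k x F y := by
    by_contra hno
    push Not at hno
    have hge : ∀ y, k ≤ edgeDeg F y + (if y = x then 1 else 0) := by
      intro y
      by_contra hlt
      apply hno y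
      refine ⟨hF, hFmax, hx, ?_⟩
      split_ifs at hlt ⊢ <;> omega
    have h1 : ∑ _y : V, k ≤ ∑ y, (edgeDeg F y + (if y = x then 1 else 0)) :=
      sum_le_sum (fun y _ => hge y)
    rw [sum_add_distrib] at h1
    simp at h1
    have h2 := aux_sum F
    unfold lamK at hlam
    rw [mul_comm] at h1
    omega
  let Y : Finset V := univ.filter (fun y => ∃ F', StateAt G k x F' y)
  have hYne : Y.Nonempty := by
    obtain ⟨y, hy⟩ := hinit
    exact ⟨y, by simp only [Y, mem_filter, mem_univ, true_and]; exact ⟨F, hy⟩⟩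
  have hYY : Y.erase x ⊆ Yset G k x := by
    intro y hy
    rw [mem_erase] at hy
    obtain ⟨hyx, hy⟩ := hy
    simp only [Y, mem_filter, mem_univ, true_and] at hy
    obtain ⟨F', h1, h2, h3, h4⟩ := hy
    unfold Yset
    simp only [mem_filter, mem_univ, true_and]
    rw [if_neg hyx] at h4
    exact ⟨hyx, F', h1, h2, h3, h4⟩
  have hex : ∀ y : V, ∃ R : Finset V, R.card ≤ 2 ∧ (∀ v ∈ R, 3 ≤ (Y.filter (fun w => G.Adj v w)).card)
      ∧ (y ∈ Y → R.card = 2 ∧ ∀ v ∈ R, G.Adj y v) := by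
    intro y
    by_cases hy : y ∈ Y
    · have hy' := hy
      simp only [Y, mem_filter, mem_univ, true_and] at hy
      obtain ⟨F', hs⟩ := hy
      obtain ⟨R, hR, hRc⟩ := exists_subset_card_eq (aux_two G k hδ x F' y hs)
      refine ⟨R, hRc.le, ?_, fun _ => ⟨hRc, fun v hv => ?_⟩⟩
      · intro v hv
        have hv' := hR hv
        simp only [mem_filter, mem_univ, true_and] at hv'
        have hsat := state_sat G k x F' y hs v hv'.1 hv'.2
        rw [aux_deg] at hsat
        have hny : y ∉ univ.filter (fun w => s(v, w) ∈ F') := by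
          simp only [mem_filter, mem_univ, true_and]
          rw [Sym2.eq_swap]
          exact hv'.2
        have hsub : insert y (univ.filter (fun w => s(v, w) ∈ F')) ⊆ Y.filter (fun w => G.Adj v w) := by
          intro w hw
          rw [mem_filter]
          rcases mem_insert.mp hw with rfl | hw
          · exact ⟨hy', hv'.1.symm⟩
          · simp only [mem_filter, mem_univ, true_and] at hw
            refine ⟨?_, ?_⟩
            · simp only [Y, mem_filter, mem_univ, true_and]
              exact ⟨_, state_step G k x F' y hs v hv'.1 hv'.2 w hw⟩
            · have := hs.1.1 hw
              rwa [SimpleGraph.mem_edgeFinset, SimpleGraph.mem_edgeSet] at this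
        have h5 := card_le_card hsub
        rw [card_insert_of_notMem hny] at h5
        have h6 : (univ.filter (fun w => s(v, w) ∈ F')).card = k := by convert hsat
        omega
      · have hv' := hR hv
        simp only [mem_filter, mem_univ, true_and] at hv'
        exact hv'.1
    · exact ⟨∅, by simp, by simp, fun h => absurd h hy⟩
  choose R hR1 hR2 hR3 using hex
  let T : Finset V := Y.biUnion R
  have hTc : T.card ≤ Y.card * 2 := card_biUnion_le_card_mul _ _ _ (fun y _ => hR1 y)
  have hE : 13 * (Y ∪ T).card ≤ 12 * edgesIn G (Y ∪ T) := by
    have := aux_edges G Y T ?_ ?_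
    · convert this
    · intro t ht
      obtain ⟨y, hy, ht⟩ := mem_biUnion.mp ht
      convert hR2 y t ht
    · intro y hy
      rw [← (hR3 y hy).1]
      apply card_le_card
      intro v hv
      rw [mem_filter]
      exact ⟨mem_biUnion.mpr ⟨y, hy, hv⟩, (hR3 y hy).2 v hv⟩
  have hSc : (Y ∪ T).card ≤ 3 * Y.card := by
    have := card_union_le Y T
    omega
  have hI : Y.card ≤ ((Y ∪ T) ∩ Yset G k x).card + 1 := by
    have h1 : Y.erase x ⊆ (Y ∪ T) ∩ Yset G k x := by
      intro v hv
      exact mem_inter.mpr ⟨mem_union_left _ (mem_of_mem_erase hv), hYY hv⟩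
    have h2 := card_le_card h1
    have h3 := pred_card_le_card_erase (s := Y) (a := x)
    omega
  refine ⟨Y ∪ T, hYne.mono subset_union_left, ?_, ?_⟩
  · have : (13 : ℝ) * (Y ∪ T).card ≤ 12 * edgesIn G (Y ∪ T) := by exact_mod_cast hE
    linarith
  · have h1 : ((Y ∪ T).card : ℝ) ≤ 3 * Y.card := by exact_mod_cast hSc
    have h2 : (Y.card : ℝ) ≤ ((Y ∪ T) ∩ Yset G k x).card + 1 := by exact_mod_cast hI
    have h3 : (2 : ℝ) ≤ k := by exact_mod_cast hk
    have h4 : ((Y ∪ T).card : ℝ) / (k + 1) ≤ Y.card := by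
      rw [div_le_iff₀ (by linarith)]
      nlinarith [(Nat.cast_nonneg Y.card : (0 : ℝ) ≤ _)]
    linarith
end

section
/- Suppose G is a graph on n vertices with minimum degree at least 4, λ_2(G) = 0, and κ_2(G) > 1. Then for every vertex w such that Z_w = {z : wz ∉ E(G) and κ_2(G + wz) < κ_2(G)} is nonempty, there exists a nonempty vertex set T_w with e(T_w) ≥ (7/6)|T_w| and |T_w ∩ Z_w| ≥ |T_w|/3. -/
open Finset
open scoped Classical

/-- A 2-factor of `G`. -/
def IsTwoFactor {V : Type*} [Fintype V] (G : SimpleGraph V) (F : Finset (Sym2 V)) : Prop :=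
  F ⊆ G.edgeFinset ∧ ∀ v : V, edgeDeg F v = 2

/-- Number of connected components of an edge set. -/
noncomputable def kappaEdges {V : Type*} (F : Finset (Sym2 V)) : ℕ :=
  Nat.card (SimpleGraph.fromEdgeSet (↑F : Set (Sym2 V))).ConnectedComponent

/-- `κ₂(G)`: the minimum number of connected components over all 2-factors of `G`. -/
noncomputable def kappaTwo {V : Type*} [Fintype V] (G : SimpleGraph V) : ℕ :=
  sInf {c : ℕ | ∃ F : Finset (Sym2 V), IsTwoFactor G F ∧ kappaEdges F = c}

/-- `Z w`: the set of `z` with `wz ∉ E(G)` whose addition decreases `κ₂`. -/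
noncomputable def Zset {V : Type*} [Fintype V] (G : SimpleGraph V) (w : V) : Finset V :=
  Finset.univ.filter (fun z : V => z ≠ w ∧ ¬ G.Adj w z ∧
    kappaTwo (G ⊔ SimpleGraph.fromEdgeSet {s(w, z)}) < kappaTwo G)

def RTwo {V : Type*} (H : SimpleGraph V) : Prop :=
  ∀ v, ∃ a b, a ≠ b ∧ ∀ x, H.Adj v x ↔ (x = a ∨ x = b)

lemma rtwo_of_deg {V : Type*} [Fintype V] (H : SimpleGraph V) :
    RTwo H ↔ ∀ v, H.degree v = 2 := by
  unfold RTwo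
  refine forall_congr' fun v => ?_
  rw [← SimpleGraph.card_neighborFinset_eq_degree, Finset.card_eq_two]
  refine exists_congr fun a => exists_congr fun b => and_congr_right fun _ => ?_
  rw [Finset.ext_iff]
  simp

lemma edgeDeg_edgeFinset {V : Type*} [Fintype V] (H : SimpleGraph V) (v : V) :
    edgeDeg H.edgeFinset v = H.degree v := by
  unfold edgeDeg
  rw [← SimpleGraph.card_incidenceFinset_eq_degree, SimpleGraph.incidenceFinset_eq_filter]

lemma kappa_le {V : Type*} [Fintype V] (G H : SimpleGraph V) (hle : H ≤ G) (h : RTwo H) :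
    kappaTwo G ≤ Nat.card H.ConnectedComponent := by
  apply Nat.sInf_le
  refine ⟨H.edgeFinset, ⟨?_, ?_⟩, ?_⟩
  · simpa using hle
  · intro v
    rw [edgeDeg_edgeFinset]
    exact (rtwo_of_deg H).1 h v
  · unfold kappaEdges
    rw [SimpleGraph.coe_edgeFinset, SimpleGraph.fromEdgeSet_edgeSet]

lemma kappa_ex {V : Type*} [Fintype V] (G : SimpleGraph V)
    (h : ∃ F : Finset (Sym2 V), IsTwoFactor G F) :
    ∃ H : SimpleGraph V, H ≤ G ∧ RTwo H ∧ Nat.card H.ConnectedComponent = kappaTwo G := by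
  have hne : {c : ℕ | ∃ F : Finset (Sym2 V), IsTwoFactor G F ∧ kappaEdges F = c}.Nonempty := by
    obtain ⟨F, hF⟩ := h
    exact ⟨_, F, hF, rfl⟩
  obtain ⟨F, hF, hk⟩ := Nat.sInf_mem hne
  have hFe : ∀ e ∈ F, e ∈ G.edgeSet := fun e he => by simpa using hF.1 he
  have hE : (SimpleGraph.fromEdgeSet (↑F : Set (Sym2 V))).edgeFinset = F := by
    ext e
    simp only [SimpleGraph.mem_edgeFinset, SimpleGraph.edgeSet_fromEdgeSet]
    constructor
    · intro h; exact h.1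
    · intro h; exact ⟨h, G.not_isDiag_of_mem_edgeSet (hFe e h)⟩
  refine ⟨SimpleGraph.fromEdgeSet ↑F, ?_, ?_, hk⟩
  · intro a b hab
    rw [SimpleGraph.fromEdgeSet_adj] at hab
    exact hFe _ hab.1
  · rw [rtwo_of_deg]
    intro v
    rw [← edgeDeg_edgeFinset]
    have h2 := hF.2 v
    rw [← hE] at h2
    convert h2

lemma reach_mono' {V : Type*} (H K : SimpleGraph V)
    (h : ∀ a b, H.Adj a b → K.Reachable a b) {a b : V} (hab : H.Reachable a b) :
    K.Reachable a b := by
  obtain ⟨p⟩ := hab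
  induction p with
  | nil => exact SimpleGraph.Reachable.refl _
  | cons e _ ih => exact (h _ _ e).trans ih

lemma cc_le {V : Type*} [Fintype V] (H K : SimpleGraph V)
    (h : ∀ a b, H.Adj a b → K.Reachable a b) :
    Nat.card K.ConnectedComponent ≤ Nat.card H.ConnectedComponent := by
  let f : H.ConnectedComponent → K.ConnectedComponent :=
    Quot.map id (fun a b hab => reach_mono' H K h hab)
  apply Nat.card_le_card_of_surjective f
  intro c
  induction c using SimpleGraph.ConnectedComponent.ind with
  | h v => exact ⟨H.connectedComponentMk v, rfl⟩

lemma handshake {V : Type*} [Fintype V] (G : SimpleGraph V) (T : Finset V) :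
    ∑ v ∈ T, (T.filter (fun x => G.Adj v x)).card = 2 * edgesIn G T := by
  let K : SimpleGraph V :=
    { Adj := fun a b => G.Adj a b ∧ a ∈ T ∧ b ∈ T
      symm := ⟨fun a b h => ⟨h.1.symm, h.2.2, h.2.1⟩⟩
      loopless := ⟨fun a h => G.loopless.irrefl a h.1⟩ }
  have hK : K.edgeFinset = G.edgeFinset.filter (fun e => ∀ v ∈ e, v ∈ T) := by
    ext e
    induction e using Sym2.ind with
    | h a b => simp [K]
  unfold edgesIn
  rw [← hK, ← SimpleGraph.sum_degrees_eq_twice_card_edges]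
  rw [← Finset.sum_subset (Finset.subset_univ T)]
  · refine Finset.sum_congr rfl fun v hv => ?_
    rw [← SimpleGraph.card_neighborFinset_eq_degree]
    congr 1
    ext x
    simp [K, hv, and_comm]
  · intro v _ hv
    rw [← SimpleGraph.card_neighborFinset_eq_degree, Finset.card_eq_zero]
    ext x
    simp [K, hv]

/-- Counting lemma. -/
lemma counting {V : Type*} [Fintype V] (G P : SimpleGraph V) (S : Finset V)
    (hδ : ∀ v : V, 4 ≤ G.degree v) (hP : P ≤ G)
    (hP2 : ∀ s, ∃ a b, ∀ x, P.Adj s x → (x = a ∨ x = b))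
    (T : Finset V) (hT : ∀ x, x ∈ T ↔ (x ∈ S ∨ ∃ s ∈ S, P.Adj s x))
    (hN : ∀ s ∈ S, ∀ u, G.Adj s u → u ∈ T)
    (hbad : ∀ s ∈ S, ∀ a b, a ≠ b → P.Adj s a → P.Adj s b → a ∉ S → b ∉ S →
      (T.filter (fun x => G.Adj a x)).card ≤ 1 → (T.filter (fun x => G.Adj b x)).card ≤ 1 → False) :
    7 * T.card ≤ 6 * edgesIn G T ∧ T.card ≤ 3 * S.card := by
  set d : V → ℕ := fun v => (T.filter (fun x => G.Adj v x)).card with hd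
  set l : V → ℕ := fun v => if d v ≤ 1 then 8 else 2 with hl
  have hST : S ⊆ T := fun s hs => (hT s).2 (Or.inl hs)
  set B := T \ S with hB
  have hcard : B.card + S.card = T.card := Finset.card_sdiff_add_card_eq_card hST
  have hB1 : ∀ b ∈ B, ∃ s ∈ S, P.Adj s b := by
    intro b hb
    rw [hB, Finset.mem_sdiff, hT] at hb
    tauto
  have hswap : ∀ f : V → ℕ, ∑ b ∈ B, f b ≤ ∑ s ∈ S, ∑ b ∈ B.filter (fun b => P.Adj s b), f b := by
    intro f
    simp_rw [Finset.sum_filter]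
    rw [Finset.sum_comm]
    refine Finset.sum_le_sum fun b hb => ?_
    obtain ⟨s, hs, hsb⟩ := hB1 b hb
    calc f b = if P.Adj s b then f b else 0 := by simp [hsb]
      _ ≤ _ := Finset.single_le_sum (f := fun s => if P.Adj s b then f b else 0)
        (fun _ _ => Nat.zero_le _) hs
  have hsub : ∀ s, ∃ a b, B.filter (fun b => P.Adj s b) ⊆ {a, b} := by
    intro s
    obtain ⟨a, b, h⟩ := hP2 s
    refine ⟨a, b, fun x hx => ?_⟩
    simp only [Finset.mem_filter] at hx
    simpa using h x hx.2
  have hBc : B.card ≤ 2 * S.card := by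
    have := hswap (fun _ => 1)
    simp only [Finset.sum_const, smul_eq_mul, mul_one] at this
    refine this.trans ?_
    rw [mul_comm, ← smul_eq_mul]
    apply Finset.sum_le_card_nsmul
    intro s hs
    obtain ⟨a, b, h⟩ := hsub s
    exact (Finset.card_le_card h).trans Finset.card_le_two
  have hloss : ∑ b ∈ B, l b ≤ 10 * S.card := by
    refine (hswap l).trans ?_
    rw [mul_comm, ← smul_eq_mul]
    apply Finset.sum_le_card_nsmul
    intro s hs
    obtain ⟨a, b, h⟩ := hsub s
    by_cases hall : a ≠ b ∧ a ∈ B.filter (fun b => P.Adj s b) ∧ b ∈ B.filter (fun b => P.Adj s b)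
    · obtain ⟨hab, ha, hb⟩ := hall
      have hle : l a + l b ≤ 10 := by
        by_contra hcon
        simp only [Finset.mem_filter, hB, Finset.mem_sdiff] at ha hb
        refine hbad s hs a b hab ha.2 hb.2 ha.1.2 hb.1.2 ?_ ?_
        · by_contra h1
          have : l a = 2 := if_neg h1
          have : l b ≤ 8 := by simp only [hl]; split_ifs <;> omega
          omega
        · by_contra h1
          have : l b = 2 := if_neg h1
          have : l a ≤ 8 := by simp only [hl]; split_ifs <;> omega
          omega
      calc _ ≤ ∑ x ∈ ({a, b} : Finset V), l x := Finset.sum_le_sum_of_subset h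
        _ = l a + l b := Finset.sum_pair hab
        _ ≤ 10 := hle
    · have : ∃ c, B.filter (fun b => P.Adj s b) ⊆ {c} := by
        by_cases hab : a = b
        · exact ⟨a, by simpa [hab] using h⟩
        · by_cases ha : a ∈ B.filter (fun b => P.Adj s b)
          · refine ⟨a, fun x hx => ?_⟩
            have := h hx
            simp only [Finset.mem_insert, Finset.mem_singleton] at this ⊢
            rcases this with rfl | rfl
            · rfl
            · exact absurd ⟨hab, ha, hx⟩ hall
          · refine ⟨b, fun x hx => ?_⟩
            have := h hx
            simp only [Finset.mem_insert, Finset.mem_singleton] at this ⊢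
            rcases this with rfl | rfl
            · exact absurd hx ha
            · rfl
      obtain ⟨c, hc⟩ := this
      calc _ ≤ ∑ x ∈ ({c} : Finset V), l x := Finset.sum_le_sum_of_subset hc
        _ = l c := Finset.sum_singleton _ _
        _ ≤ 10 := by simp only [hl]; split_ifs <;> omega
  have hdS : 4 * S.card ≤ ∑ s ∈ S, d s := by
    rw [mul_comm, ← smul_eq_mul]
    apply Finset.card_nsmul_le_sum
    intro s hs
    refine (hδ s).trans ?_
    rw [← SimpleGraph.card_neighborFinset_eq_degree]
    apply Finset.card_le_card
    intro u hu
    rw [SimpleGraph.mem_neighborFinset] at hu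
    exact Finset.mem_filter.2 ⟨hN s hs u hu, hu⟩
  have hdB : 14 * B.card ≤ 6 * ∑ b ∈ B, d b + ∑ b ∈ B, l b := by
    rw [Finset.mul_sum, ← Finset.sum_add_distrib, mul_comm, ← smul_eq_mul]
    apply Finset.card_nsmul_le_sum
    intro b hb
    obtain ⟨s, hs, hsb⟩ := hB1 b hb
    have h1 : 1 ≤ d b := Finset.card_pos.2 ⟨s, Finset.mem_filter.2 ⟨hST hs, (hP hsb).symm⟩⟩
    simp only [hl]
    split_ifs <;> omega
  have hsum : ∑ b ∈ B, d b + ∑ s ∈ S, d s = ∑ v ∈ T, d v := Finset.sum_sdiff hST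
  have := handshake G T
  constructor
  · simp only [hd] at *
    omega
  · omega

lemma RTwo.third {V : Type*} {H : SimpleGraph V} (h : RTwo H) {v a b c : V} (ha : H.Adj v a)
    (hb : H.Adj v b) (hc : H.Adj v c) (hab : a ≠ b) : c = a ∨ c = b := by
  obtain ⟨p, q, hpq, h⟩ := h v
  rw [h] at ha hb hc
  grind

lemma RTwo.other {V : Type*} {H : SimpleGraph V} (h : RTwo H) {v a : V} (ha : H.Adj v a) :
    ∃ c, c ≠ a ∧ ∀ x, H.Adj v x ↔ (x = a ∨ x = c) := by
  obtain ⟨p, q, hpq, h⟩ := h v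
  rcases (h a).1 ha with rfl | rfl
  · exact ⟨q, hpq.symm, h⟩
  · exact ⟨p, hpq, fun x => by rw [h, or_comm]⟩

lemma RTwo.isCycles {V : Type*} {H : SimpleGraph V} (h : RTwo H) : H.IsCycles := by
  intro v _
  obtain ⟨a, b, hab, h⟩ := h v
  rw [Set.ncard_eq_two]
  refine ⟨a, b, hab, ?_⟩
  ext x
  simp [h]

def rot {V : Type*} (H : SimpleGraph V) (w s u y : V) : SimpleGraph V :=
  H.deleteEdges {s(w, s), s(u, y)} ⊔ SimpleGraph.fromEdgeSet {s(s, u), s(w, y)}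

lemma rot_adj {V : Type*} (H : SimpleGraph V) (w s u y a b : V) :
    (rot H w s u y).Adj a b ↔ (H.Adj a b ∧ s(a, b) ≠ s(w, s) ∧ s(a, b) ≠ s(u, y)) ∨
      (a ≠ b ∧ (s(a, b) = s(s, u) ∨ s(a, b) = s(w, y))) := by
  unfold rot
  simp only [SimpleGraph.sup_adj, SimpleGraph.deleteEdges_adj, SimpleGraph.fromEdgeSet_adj,
    Set.mem_insert_iff, Set.mem_singleton_iff, not_or, ne_eq]
  tauto

lemma rot_rtwo {V : Type*} {H : SimpleGraph V} (h : RTwo H) {w s u y : V} (hws : H.Adj w s)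
    (hsu : ¬ H.Adj s u) (hne : s ≠ u) (huy : H.Adj u y) (hyw : y ≠ w) (hwy : ¬ H.Adj w y) :
    RTwo (rot H w s u y) := by
  have hsy : y ≠ s := by rintro rfl; exact hsu huy.symm
  have huw : u ≠ w := by rintro rfl; exact hsu hws.symm
  have h1 := hws.ne
  have h2 := huy.ne
  intro v
  simp only [rot_adj]
  by_cases hvw : v = w
  · subst hvw
    obtain ⟨c, hc, hx⟩ := h.other hws
    refine ⟨y, c, ?_, fun x => ?_⟩
    · rintro rfl; exact hwy ((hx _).2 (Or.inr rfl))
    · have := hx x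
      have h3 : x = c → v ≠ x := by rintro rfl; exact ((hx _).2 (Or.inr rfl)).ne
      simp only [Sym2.eq_iff, ne_eq]
      grind
  by_cases hvs : v = s
  · subst hvs
    obtain ⟨c, hc, hx⟩ := h.other hws.symm
    refine ⟨u, c, ?_, fun x => ?_⟩
    · rintro rfl; exact hsu ((hx _).2 (Or.inr rfl))
    · have := hx x
      have h3 : x = c → v ≠ x := by rintro rfl; exact ((hx _).2 (Or.inr rfl)).ne
      simp only [Sym2.eq_iff, ne_eq]
      grind
  by_cases hvu : v = u
  · subst hvu
    obtain ⟨c, hc, hx⟩ := h.other huy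
    refine ⟨s, c, ?_, fun x => ?_⟩
    · rintro rfl; exact hsu ((hx _).2 (Or.inr rfl)).symm
    · have := hx x
      have h3 : x = c → v ≠ x := by rintro rfl; exact ((hx _).2 (Or.inr rfl)).ne
      simp only [Sym2.eq_iff, ne_eq]
      grind
  by_cases hvy : v = y
  · subst hvy
    obtain ⟨c, hc, hx⟩ := h.other huy.symm
    refine ⟨w, c, ?_, fun x => ?_⟩
    · rintro rfl; exact hwy ((hx _).2 (Or.inr rfl)).symm
    · have := hx x
      have h3 : x = c → v ≠ x := by rintro rfl; exact ((hx _).2 (Or.inr rfl)).ne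
      simp only [Sym2.eq_iff, ne_eq]
      grind
  · obtain ⟨a, b, hab, hx⟩ := h v
    refine ⟨a, b, hab, fun x => ?_⟩
    have := hx x
    simp only [Sym2.eq_iff, ne_eq]
    grind

lemma path_last {V : Type*} {K : SimpleGraph V} {a b : V} (p : K.Walk a b) (hp : p.IsPath)
    (hab : a ≠ b) : ∃ t, K.Adj t b ∧ ∃ r : K.Walk a t, r.IsPath ∧ b ∉ r.support ∧
      ∀ x ∈ r.support, x ∈ p.support := by
  have hq : p.reverse.IsPath := hp.reverse
  have hs : ∀ x, x ∈ p.reverse.support → x ∈ p.support := by simp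
  generalize p.reverse = q at hq hs
  cases q with
  | nil => exact absurd rfl hab
  | cons h r =>
    rw [SimpleGraph.Walk.cons_isPath_iff] at hq
    refine ⟨_, h.symm, r.reverse, hq.1.reverse, by simpa using hq.2, fun x hx => hs x ?_⟩
    simp only [SimpleGraph.Walk.support_cons, List.mem_cons]
    right
    simpa using hx

lemma rot_ex {V : Type*} [Fintype V] {H : SimpleGraph V} (h : RTwo H) {w s u : V}
    (hws : H.Adj w s) (hsu : ¬ H.Adj s u) (hne : s ≠ u) :
    ∃ y, H.Adj u y ∧ y ≠ w ∧ ¬ H.Adj w y ∧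
      ((H.deleteEdges {s(w, s), s(u, y)}).Reachable w u ∨
        (H.deleteEdges {s(w, s), s(u, y)}).Reachable u y) := by
  have huw : u ≠ w := by rintro rfl; exact hsu hws.symm
  have h1 := hws.ne
  have hF : ∀ a b, (H.deleteEdges {s(w, s)}).Adj a b ↔ H.Adj a b ∧ s(a, b) ≠ s(w, s) := by
    intro a b
    simp [SimpleGraph.deleteEdges_adj]
  by_cases hr : (H.deleteEdges {s(w, s)}).Reachable w u
  · obtain ⟨q, hq⟩ := hr.exists_isPath
    obtain ⟨y₀, hy₀, r, hrp, hur, -⟩ := path_last q hq huw.symm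
    have hy₀' := (hF _ _).1 hy₀
    obtain ⟨y, hyy, hy⟩ := h.other hy₀'.1.symm
    have huy : H.Adj u y := (hy y).2 (Or.inr rfl)
    have hys : y ≠ s := by rintro rfl; exact hsu huy.symm
    -- the neighbour of `w` on the path
    have key : w ≠ y₀ → ∃ t, t ≠ u ∧ t ≠ s ∧ H.Adj t w ∧ (t ≠ y₀ → ∃ t₂, t₂ ≠ u ∧ t₂ ≠ w ∧ H.Adj t₂ t) := by
      intro hw0
      obtain ⟨t, ht, r₂, hr₂, hwr₂, hsub⟩ := path_last r.reverse hrp.reverse hw0.symm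
      have ht' := (hF _ _).1 ht
      refine ⟨t, ?_, ?_, ht'.1, ?_⟩
      · rintro rfl
        exact hur (by simpa using hsub t (by simp))
      · rintro rfl
        exact ht'.2 Sym2.eq_swap
      · intro hty
        obtain ⟨t₂, ht₂, r₃, hr₃, -, hsub₃⟩ := path_last r₂ hr₂ hty.symm
        refine ⟨t₂, ?_, ?_, ((hF _ _).1 ht₂).1⟩
        · rintro rfl
          exact hur (by simpa using hsub t₂ (hsub₃ t₂ (by simp)))
        · rintro rfl
          exact hwr₂ (hsub₃ t₂ (by simp))
    have hyw : y ≠ w := by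
      rintro rfl
      obtain ⟨t, h1t, h2t, h3t, -⟩ := key hyy
      rcases h.third hws huy.symm h3t.symm hne with h | h
      · exact h2t h
      · exact h1t h
    refine ⟨y, huy, hyw, ?_, Or.inl ?_⟩
    · intro hwy
      by_cases hw0 : w = y₀
      · subst hw0
        rcases h.third hws hwy hy₀'.1 hys.symm with h | h
        · exact hne h.symm
        · exact huy.ne h
      · obtain ⟨t, h1t, h2t, h3t, h4t⟩ := key hw0
        rcases h.third hws hwy h3t.symm hys.symm with h' | h'
        · exact h2t h'
        · subst h'
          obtain ⟨t₂, h5, h6, h7⟩ := h4t hyy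
          rcases h.third huy.symm hwy.symm h7.symm huw with h | h
          · exact h5 h
          · exact h6 h
    · have hadj : (H.deleteEdges {s(w, s), s(u, y)}).Adj y₀ u := by
        rw [SimpleGraph.deleteEdges_adj]
        refine ⟨hy₀'.1, ?_⟩
        have := hy₀'.2
        simp only [Set.mem_insert_iff, Set.mem_singleton_iff, not_or]
        refine ⟨this, ?_⟩
        rw [Sym2.eq_iff]
        rintro (⟨h, h'⟩ | ⟨h, h'⟩)
        · exact huy.ne h'
        · exact hyy h.symm
      refine SimpleGraph.Reachable.trans ?_ hadj.reachable
      refine ⟨r.transfer _ ?_⟩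
      intro e he
      have h2 := SimpleGraph.Walk.edges_subset_edgeSet r he
      rw [SimpleGraph.edgeSet_deleteEdges] at h2 ⊢
      refine ⟨h2.1, ?_⟩
      rintro (h3 | h3)
      · exact h2.2 h3
      · rw [Set.mem_singleton_iff] at h3
        subst h3
        exact hur (r.fst_mem_support_of_mem_edges he)
  · obtain ⟨y, b, hyb, hy⟩ := h u
    have huy : H.Adj u y := (hy y).2 (Or.inl rfl)
    have hys : y ≠ s := by rintro rfl; exact hsu huy.symm
    have hFuy : (H.deleteEdges {s(w, s)}).Adj u y := by
      rw [hF]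
      refine ⟨huy, ?_⟩
      rw [ne_eq, Sym2.eq_iff]
      rintro (⟨h, h'⟩ | ⟨h, h'⟩)
      · exact huw h
      · exact hne h.symm
    have hyw : y ≠ w := by
      rintro rfl
      exact hr hFuy.symm.reachable
    refine ⟨y, huy, hyw, ?_, Or.inr ?_⟩
    · intro hwy
      apply hr
      refine SimpleGraph.Reachable.trans (v := y) ?_ hFuy.symm.reachable
      apply SimpleGraph.Adj.reachable
      rw [hF]
      refine ⟨hwy, ?_⟩
      rw [ne_eq, Sym2.eq_iff]
      rintro (⟨h, h'⟩ | ⟨h, h'⟩)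
      · exact hys h'
      · exact h1 h
    · have hdel := SimpleGraph.IsCycles.reachable_deleteEdges hws h.isCycles
      have hall : ∀ a b, H.Reachable a b → (H.deleteEdges {s(w, s)}).Reachable a b := by
        intro a b hab
        refine reach_mono' H _ ?_ hab
        intro a b hab
        by_cases he : s(a, b) = s(w, s)
        · rcases Sym2.eq_iff.1 he with ⟨rfl, rfl⟩ | ⟨rfl, rfl⟩
          · exact hdel
          · exact hdel.symm
        · exact ((hF a b).2 ⟨hab, he⟩).reachable
      have hd2 := SimpleGraph.IsCycles.reachable_deleteEdges huy h.isCycles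
      rw [SimpleGraph.reachable_deleteEdges_iff_exists_walk] at hd2
      obtain ⟨p, hp⟩ := hd2
      refine ⟨p.transfer _ ?_⟩
      intro e he
      rw [SimpleGraph.edgeSet_deleteEdges]
      refine ⟨SimpleGraph.Walk.edges_subset_edgeSet p he, ?_⟩
      rintro (h3 | h3)
      · subst h3
        have hw := p.fst_mem_support_of_mem_edges he
        exact hr (hall w u (p.takeUntil w hw).reachable.symm)
      · rw [Set.mem_singleton_iff] at h3
        subst h3
        exact hp he

lemma rot_cc {V : Type*} [Fintype V] {H : SimpleGraph V} {w s u y : V}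
    (hne : s ≠ u) (hyw : y ≠ w)
    (hr : (H.deleteEdges {s(w, s), s(u, y)}).Reachable w u ∨
        (H.deleteEdges {s(w, s), s(u, y)}).Reachable u y) :
    Nat.card (rot H w s u y).ConnectedComponent ≤ Nat.card H.ConnectedComponent := by
  have hle : H.deleteEdges {s(w, s), s(u, y)} ≤ rot H w s u y := le_sup_left
  have hsu : (rot H w s u y).Reachable s u :=
    SimpleGraph.Adj.reachable ((rot_adj ..).2 (Or.inr ⟨hne, Or.inl rfl⟩))
  have hwy : (rot H w s u y).Reachable w y :=
    SimpleGraph.Adj.reachable ((rot_adj ..).2 (Or.inr ⟨hyw.symm, Or.inr rfl⟩))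
  have hcon : (rot H w s u y).Reachable w u := by
    rcases hr with hr | hr
    · exact hr.mono hle
    · exact hwy.trans (hr.mono hle).symm
  apply cc_le
  intro a b hab
  by_cases h1 : s(a, b) = s(w, s)
  · rcases Sym2.eq_iff.1 h1 with ⟨rfl, rfl⟩ | ⟨rfl, rfl⟩
    · exact hcon.trans hsu.symm
    · exact (hcon.trans hsu.symm).symm
  by_cases h2 : s(a, b) = s(u, y)
  · rcases Sym2.eq_iff.1 h2 with ⟨rfl, rfl⟩ | ⟨rfl, rfl⟩
    · exact hcon.symm.trans hwy
    · exact (hcon.symm.trans hwy).symm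
  exact SimpleGraph.Adj.reachable ((rot_adj ..).2 (Or.inl ⟨hab, h1, h2⟩))

structure St {V : Type*} (G : SimpleGraph V) (w : V) (k : ℕ) (H : SimpleGraph V) (s : V) : Prop where
  two : RTwo H
  adj : H.Adj w s
  sub : ∀ a b, H.Adj a b → G.Adj a b ∨ s(a, b) = s(w, s)
  cc : Nat.card H.ConnectedComponent ≤ k

lemma St.mem {V : Type*} [Fintype V] {G : SimpleGraph V} {w : V} {k : ℕ} {H : SimpleGraph V}
    {s : V} (h : St G w k H s) (hk : k < kappaTwo G) : s ∈ Zset G w := by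
  unfold Zset
  rw [Finset.mem_filter]
  refine ⟨Finset.mem_univ _, h.adj.ne', ?_, ?_⟩
  · intro hadj
    have : H ≤ G := by
      intro a b hab
      rcases h.sub a b hab with h | h
      · exact h
      · rcases Sym2.eq_iff.1 h with ⟨rfl, rfl⟩ | ⟨rfl, rfl⟩
        · exact hadj
        · exact hadj.symm
    have := kappa_le G H this h.two
    have := h.cc
    omega
  · refine lt_of_le_of_lt ((kappa_le _ H ?_ h.two).trans h.cc) hk
    intro a b hab
    rw [SimpleGraph.sup_adj, SimpleGraph.fromEdgeSet_adj]
    rcases h.sub a b hab with h | h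
    · exact Or.inl h
    · exact Or.inr ⟨h, hab.ne⟩

inductive Rch {V : Type*} (G : SimpleGraph V) (w : V) (k : ℕ) (H₀ : SimpleGraph V) (z : V) :
    SimpleGraph V → V → Prop
  | base : Rch G w k H₀ z H₀ z
  | step (H : SimpleGraph V) (s u y : V) : Rch G w k H₀ z H s → G.Adj s u → ¬ H.Adj s u →
      H.Adj u y → St G w k (rot H w s u y) y → Rch G w k H₀ z (rot H w s u y) y

lemma rch_step {V : Type*} [Fintype V] {G : SimpleGraph V} {w : V} {k : ℕ} {H₀ H : SimpleGraph V}
    {z s u : V} (hR : Rch G w k H₀ z H s) (hS : St G w k H s) (hsu : G.Adj s u)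
    (hn : ¬ H.Adj s u) : ∃ y, H.Adj u y ∧ Rch G w k H₀ z (rot H w s u y) y := by
  obtain ⟨y, huy, hyw, hwy, hr⟩ := rot_ex hS.two hS.adj hn hsu.ne
  refine ⟨y, huy, Rch.step H s u y hR hsu hn huy ⟨?_, ?_, ?_, ?_⟩⟩
  · exact rot_rtwo hS.two hS.adj hn hsu.ne huy hyw hwy
  · exact (rot_adj ..).2 (Or.inr ⟨hyw.symm, Or.inr rfl⟩)
  · intro a b hab
    rcases (rot_adj ..).1 hab with ⟨h1, h2, h3⟩ | ⟨h1, h2 | h2⟩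
    · rcases hS.sub a b h1 with h | h
      · exact Or.inl h
      · exact absurd h h2
    · rcases Sym2.eq_iff.1 h2 with ⟨rfl, rfl⟩ | ⟨rfl, rfl⟩
      · exact Or.inl hsu
      · exact Or.inl hsu.symm
    · exact Or.inr h2
  · exact (rot_cc hsu.ne hyw hr).trans hS.cc

lemma IsTwoFactor.mono {V : Type*} [Fintype V] {G G' : SimpleGraph V} {F : Finset (Sym2 V)}
    (hF : IsTwoFactor G F) (hle : G ≤ G') : IsTwoFactor G' F := by
  refine ⟨fun e he => ?_, hF.2⟩
  have := hF.1 he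
  rw [SimpleGraph.mem_edgeFinset] at this ⊢
  exact SimpleGraph.edgeSet_mono hle this

lemma main_aux {V : Type*} [Fintype V] (G : SimpleGraph V)
    (hδ : ∀ v : V, 4 ≤ G.degree v)
    (h2f : ∃ F : Finset (Sym2 V), IsTwoFactor G F) (w : V) (hZ : (Zset G w).Nonempty) :
    ∃ S T : Finset V, S.Nonempty ∧ S ⊆ T ∧ S ⊆ Zset G w ∧
      7 * T.card ≤ 6 * edgesIn G T ∧ T.card ≤ 3 * S.card := by
  obtain ⟨z, hz⟩ := hZ
  have hz' := hz
  unfold Zset at hz'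
  rw [Finset.mem_filter] at hz'
  obtain ⟨-, hzw, hnwz, hlt⟩ := hz'
  obtain ⟨H₀, hH₀, hH₀2, hH₀k⟩ := kappa_ex (G ⊔ SimpleGraph.fromEdgeSet {s(w, z)}) 
    (h2f.imp fun F hF => hF.mono le_sup_left)
  set k := kappaTwo (G ⊔ SimpleGraph.fromEdgeSet {s(w, z)}) with hk
  have hsub0 : ∀ a b, H₀.Adj a b → G.Adj a b ∨ s(a, b) = s(w, z) := by
    intro a b hab
    have := hH₀ hab
    rw [SimpleGraph.sup_adj, SimpleGraph.fromEdgeSet_adj] at this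
    rcases this with h | h
    · exact Or.inl h
    · exact Or.inr h.1
  have hwz0 : H₀.Adj w z := by
    by_contra hcon
    have : H₀ ≤ G := by
      intro a b hab
      rcases hsub0 a b hab with h | h
      · exact h
      · exfalso
        rcases Sym2.eq_iff.1 h with ⟨rfl, rfl⟩ | ⟨rfl, rfl⟩
        · exact hcon hab
        · exact hcon hab.symm
    have := kappa_le G H₀ this hH₀2
    omega
  have hSt : ∀ H s, Rch G w k H₀ z H s → St G w k H s := by
    intro H s h
    cases h with
    | base => exact ⟨hH₀2, hwz0, hsub0, hH₀k.le⟩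
    | step _ _ _ _ _ _ _ _ h => exact h
  let S : Finset V := Finset.univ.filter (fun s => ∃ H, Rch G w k H₀ z H s)
  have hS : ∀ s, s ∈ S ↔ ∃ H, Rch G w k H₀ z H s := by simp [S]
  have hSR : ∀ {H s}, Rch G w k H₀ z H s → s ∈ S := fun h => (hS _).2 ⟨_, h⟩
  have hSZ : S ⊆ Zset G w := by
    intro s hs
    obtain ⟨H, hH⟩ := (hS s).1 hs
    exact (hSt H s hH).mem hlt
  have hSG : ∀ s ∈ S, ¬ G.Adj w s := by
    intro s hs
    have := hSZ hs
    unfold Zset at this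
    rw [Finset.mem_filter] at this
    exact this.2.2.1
  have hedge : ∀ s ∈ S, ∀ a b, G.Adj a b → s(a, b) ≠ s(w, s) := by
    intro s hs a b hab he
    rcases Sym2.eq_iff.1 he with ⟨rfl, rfl⟩ | ⟨rfl, rfl⟩
    · exact hSG _ hs hab
    · exact hSG _ hs hab.symm
  have hzS : z ∈ S := hSR Rch.base
  let P : SimpleGraph V := H₀ ⊓ G
  have hPadj : ∀ a b, P.Adj a b ↔ H₀.Adj a b ∧ G.Adj a b := fun a b => SimpleGraph.inf_adj ..
  have hPtwo : ∀ u, u ≠ w → u ≠ z → ∃ a b, a ≠ b ∧ P.Adj u a ∧ P.Adj u b := by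
    intro u hw hz
    obtain ⟨a, b, hab, h⟩ := hH₀2 u
    have hgen : ∀ x, H₀.Adj u x → P.Adj u x := by
      intro x hx
      refine (hPadj _ _).2 ⟨hx, ?_⟩
      rcases hsub0 u x hx with h | h
      · exact h
      · rcases Sym2.eq_iff.1 h with ⟨h, -⟩ | ⟨h, -⟩
        · exact absurd h hw
        · exact absurd h hz
    exact ⟨a, b, hab, hgen a ((h a).2 (Or.inl rfl)), hgen b ((h b).2 (Or.inr rfl))⟩
  -- first invariant
  have inv1 : ∀ a b, P.Adj a b → a ∉ S → b ∉ S → ∀ H s, Rch G w k H₀ z H s → H.Adj a b := by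
    intro a b hab ha hb H s hR
    induction hR with
    | base => exact ((hPadj _ _).1 hab).1
    | step H s u y hR hsu hn huy hst ih =>
      have hy : y ∈ S := hSR (Rch.step H s u y hR hsu hn huy hst)
      refine (rot_adj ..).2 (Or.inl ⟨ih, hedge s (hSR hR) a b ((hPadj _ _).1 hab).2, ?_⟩)
      intro he
      rcases Sym2.eq_iff.1 he with ⟨rfl, rfl⟩ | ⟨rfl, rfl⟩
      · exact hb hy
      · exact ha hy
  -- second invariant
  have inv2 : ∀ x a, P.Adj x a → a ∉ S → (∀ t ∈ S, G.Adj t a → t = x) →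
      ∀ H s, Rch G w k H₀ z H s → H.Adj x a := by
    intro x a hxa ha ht H s hR
    induction hR with
    | base => exact ((hPadj _ _).1 hxa).1
    | step H s u y hR hsu hn huy hst ih =>
      have hy : y ∈ S := hSR (Rch.step H s u y hR hsu hn huy hst)
      refine (rot_adj ..).2 (Or.inl ⟨ih, hedge s (hSR hR) x a ((hPadj _ _).1 hxa).2, ?_⟩)
      intro he
      rcases Sym2.eq_iff.1 he with ⟨rfl, rfl⟩ | ⟨rfl, rfl⟩
      · exact ha hy
      · have := ht s (hSR hR) hsu
        subst this
        exact hn huy.symm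
  let T : Finset V := Finset.univ.filter (fun x => x ∈ S ∨ ∃ s ∈ S, P.Adj s x)
  have hT : ∀ x, x ∈ T ↔ (x ∈ S ∨ ∃ s ∈ S, P.Adj s x) := by simp [T]
  have hST : S ⊆ T := fun x hx => (hT x).2 (Or.inl hx)
  refine ⟨S, T, ⟨z, hzS⟩, hST, hSZ, ?_⟩
  refine counting G P S hδ inf_le_right ?_ T hT ?_ ?_
  · intro s
    obtain ⟨a, b, -, h⟩ := hH₀2 s
    exact ⟨a, b, fun x hx => (h x).1 ((hPadj _ _).1 hx).1⟩
  · intro s hs u hsu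
    by_contra huT
    rw [hT, not_or] at huT
    obtain ⟨huS, huP⟩ := huT
    have huw : u ≠ w := by rintro rfl; exact hSG s hs hsu.symm
    have huz : u ≠ z := by rintro rfl; exact huS hzS
    obtain ⟨a, b, hab, ha, hb⟩ := hPtwo u huw huz
    have haS : a ∉ S := fun h => huP ⟨a, h, ha.symm⟩
    have hbS : b ∉ S := fun h => huP ⟨b, h, hb.symm⟩
    obtain ⟨H, hR⟩ := (hS s).1 hs
    have hst := hSt H s hR
    have hHa := inv1 u a ha huS haS H s hR
    have hHb := inv1 u b hb huS hbS H s hR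
    have key : ∀ y, H.Adj u y → y ∉ S := by
      intro y hy
      rcases hst.two.third hHa hHb hy hab with rfl | rfl
      · exact haS
      · exact hbS
    obtain ⟨y, huy, hRy⟩ := rch_step hR hst hsu (fun h => key s h.symm hs)
    exact key y huy (hSR hRy)
  · intro x hx a b hab ha hb haS hbS hda hdb
    have hu : ∀ c, P.Adj x c → (T.filter (fun x => G.Adj c x)).card ≤ 1 →
        ∀ t ∈ S, G.Adj t c → t = x := by
      intro c hc hd t ht htc
      rw [Finset.card_le_one] at hd
      exact hd t (Finset.mem_filter.2 ⟨hST ht, htc.symm⟩) x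
        (Finset.mem_filter.2 ⟨hST hx, ((hPadj _ _).1 hc).2.symm⟩)
    obtain ⟨H, hR⟩ := (hS x).1 hx
    have hst := hSt H x hR
    have hHa := inv2 x a ha haS (hu a ha hda) H x hR
    have hHb := inv2 x b hb hbS (hu b hb hdb) H x hR
    rcases hst.two.third hHa hHb hst.adj.symm hab with h | h
    · subst h
      exact hSG x hx ((hPadj _ _).1 ha).2.symm
    · subst h
      exact hSG x hx ((hPadj _ _).1 hb).2.symm

theorem stmt6 {V : Type*} [Fintype V] [DecidableEq V] (G : SimpleGraph V)
    (hδ : ∀ v : V, 4 ≤ G.degree v)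
    (h2f : ∃ F : Finset (Sym2 V), IsTwoFactor G F)
    (hκ : 1 < kappaTwo G) :
    ∀ w : V, (Zset G w).Nonempty →
      ∃ T : Finset V, T.Nonempty ∧
        (7 / 6 : ℝ) * T.card ≤ (edgesIn G T : ℝ) ∧
        (T.card : ℝ) / 3 ≤ ((T ∩ Zset G w).card : ℝ) := by
  intro w hZ
  obtain ⟨S, T, hne, hST, hSZ, h1, h2⟩ := main_aux G (fun v => by convert hδ v) h2f w hZ
  have h3 : S.card ≤ (T ∩ Zset G w).card := by
    apply Finset.card_le_card
    intro x hx
    exact Finset.mem_inter.2 ⟨hST hx, hSZ hx⟩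
  refine ⟨T, hne.mono hST, ?_, ?_⟩
  · have : (7 : ℝ) * T.card ≤ 6 * edgesIn G T := by exact_mod_cast h1
    linarith
  · have h4 : (T.card : ℝ) ≤ 3 * S.card := by exact_mod_cast h2
    have h5 : (S.card : ℝ) ≤ ((T ∩ Zset G w).card : ℝ) := by exact_mod_cast h3
    linarith
end
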